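/- arXiv:1408.6116 — 4 statements merged into one kernel-verified Lean document; each statement's English description precedes it below -/
import Mathlib

section
/- There exists a 118 × 118 matrix with all entries in {+1, −1} whose determinant has absolute value 2^59 · 117 · 58^58, i.e., a D-optimal design of order 118 exists. -/
/-- The `±1` sequence of length 59 whose negative positions are the bits of `n`. -/
def dopSeq (n : ℕ) (i : ZMod 59) : ℤ := if n.testBit i.val then -1 else 1

/-- The first sequence. -/
def dopA : ZMod 59 → ℤ := dopSeq 262184434009784710

/-- The second sequence. -/
def dopB : ZMod 59 → ℤ := dopSeq 24809440367133227

theorem dopSeq_pm (n : ℕ) (i : ZMod 59) : dopSeq n i = 1 ∨ dopSeq n i = -1 := by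
  unfold dopSeq
  split_ifs <;> simp

/-- The autocorrelations of the two sequences sum to 2 (off the origin). -/
theorem dop_autocorr : ∀ i : ZMod 59,
    (∑ j : ZMod 59, dopA (i - j) * dopA (-j)) + (∑ j : ZMod 59, dopB (i - j) * dopB (-j))
      = if i = 0 then 118 else 2 := by
  decide +kernel

/-- The target Gram block `116 I + 2 J`. -/
def dopL : Matrix (ZMod 59) (ZMod 59) ℤ := Matrix.of fun i j => if i = j then 118 else 2

theorem dop_gram : Matrix.circulant dopA * (Matrix.circulant dopA).transpose
    + Matrix.circulant dopB * (Matrix.circulant dopB).transpose = dopL := by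
  rw [Matrix.transpose_circulant, Matrix.transpose_circulant, Matrix.circulant_mul,
    Matrix.circulant_mul, ← Matrix.circulant_add]
  ext i j
  have h := dop_autocorr (i - j)
  simp only [sub_eq_zero] at h
  simpa [dopL, Matrix.circulant_apply, Matrix.mulVec, dotProduct] using h

/-- The two-circulant design. -/
def dopM : Matrix (ZMod 59 ⊕ ZMod 59) (ZMod 59 ⊕ ZMod 59) ℤ :=
  Matrix.fromBlocks (Matrix.circulant dopA) (Matrix.circulant dopB)
    (-(Matrix.circulant dopB).transpose) (Matrix.circulant dopA).transpose

theorem dopM_mul : dopM * dopM.transpose = Matrix.fromBlocks dopL 0 0 dopL := by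
  have hAA : (Matrix.circulant dopA).transpose * Matrix.circulant dopA
      = Matrix.circulant dopA * (Matrix.circulant dopA).transpose := by
    rw [Matrix.transpose_circulant, Matrix.circulant_mul_comm]
  have hBB : (Matrix.circulant dopB).transpose * Matrix.circulant dopB
      = Matrix.circulant dopB * (Matrix.circulant dopB).transpose := by
    rw [Matrix.transpose_circulant, Matrix.circulant_mul_comm]
  have hAB : Matrix.circulant dopB * Matrix.circulant dopA
      = Matrix.circulant dopA * Matrix.circulant dopB := Matrix.circulant_mul_comm _ _
  have hABt : (Matrix.circulant dopB).transpose * (Matrix.circulant dopA).transpose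
      = (Matrix.circulant dopA).transpose * (Matrix.circulant dopB).transpose := by
    rw [← Matrix.transpose_mul, ← Matrix.transpose_mul, hAB]
  rw [dopM, Matrix.fromBlocks_transpose, Matrix.fromBlocks_multiply]
  simp only [Matrix.transpose_neg, Matrix.transpose_transpose, Matrix.mul_neg, Matrix.neg_mul,
    neg_neg, hAA, hBB, hAB, hABt, dop_gram, neg_add_cancel]
  rw [add_comm (Matrix.circulant dopB * _), dop_gram]

theorem dopL_det : dopL.det = 116 ^ 58 * 234 := by
  have h : ((dopL.det : ℤ) : ℚ) = 116 ^ 58 * 234 := by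
    rw [Int.cast_det]
    have e : (dopL.map fun x : ℤ => (x : ℚ)) = (116 : ℚ) • (1 + Matrix.replicateCol Unit
        (fun _ : ZMod 59 => (1 / 58 : ℚ)) * Matrix.replicateRow Unit (fun _ : ZMod 59 => (1 : ℚ))) := by
      ext i j
      by_cases hij : i = j
      · subst hij
        simp [dopL, Matrix.mul_apply]
        norm_num
      · simp [dopL, Matrix.mul_apply, hij]
        norm_num
    rw [e, Matrix.det_smul, Matrix.det_one_add_replicateCol_mul_replicateRow]
    simp only [dotProduct, Finset.sum_const, Finset.card_univ, ZMod.card]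
    norm_num
  exact_mod_cast h

theorem dopM_det : dopM.det.natAbs = 2 ^ 59 * 117 * 58 ^ 58 := by
  have h2 : dopM.det.natAbs * dopM.det.natAbs
      = (2 ^ 59 * 117 * 58 ^ 58) * (2 ^ 59 * 117 * 58 ^ 58) := by
    have h3 : ((dopM.det.natAbs * dopM.det.natAbs : ℕ) : ℤ)
      = (((2 ^ 59 * 117 * 58 ^ 58) * (2 ^ 59 * 117 * 58 ^ 58) : ℕ) : ℤ) := by
      rw [Int.natAbs_mul_self]
      have h := congrArg Matrix.det dopM_mul
      rw [Matrix.det_mul, Matrix.det_transpose, Matrix.det_fromBlocks_zero₂₁, dopL_det] at h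
      rw [h]
      norm_num
    exact_mod_cast h3
  exact Nat.mul_self_inj.mp h2

/-- A D-optimal design of order 118 exists: there is a 118×118 matrix with entries
in {+1, −1} whose determinant has absolute value 2^59 · 117 · 58^58,
the Ehlich–Wojtas bound for order 2v = 118. -/
theorem doptimal_design_order_118 :
    ∃ A : Matrix (Fin 118) (Fin 118) ℤ,
      (∀ i j, A i j = 1 ∨ A i j = -1) ∧
      A.det.natAbs = 2 ^ 59 * 117 * 58 ^ 58 := by
  have e : ZMod 59 ⊕ ZMod 59 ≃ Fin 118 := Fintype.equivFinOfCardEq (by simp [ZMod.card])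
  refine ⟨Matrix.reindex e e dopM, ?_, ?_⟩
  · intro i j
    rw [Matrix.reindex_apply, Matrix.submatrix_apply]
    rcases e.symm i with a | a <;> rcases e.symm j with b | b
    · exact dopSeq_pm _ _
    · exact dopSeq_pm _ _
    · have h := dopSeq_pm 24809440367133227 (b - a)
      simp only [dopM, Matrix.fromBlocks_apply₂₁, Matrix.neg_apply, Matrix.transpose_apply,
        Matrix.circulant_apply, dopB]
      omega
    · exact dopSeq_pm _ _
  · rw [Matrix.det_reindex_self]
    exact dopM_det
end

section
/- There exists a 138 × 138 matrix with all entries in {+1, −1} whose determinant has absolute value 2^69 · 137 · 68^68, i.e., a D-optimal design of order 138 exists. -/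
/-- First row sequence of the two-circulant D-optimal design, bit `i` set iff the entry is `+1`. -/
def seqA (i : Fin 69) : ℤ := bif (25188427420583951836 / 2 ^ i.val % 2 == 1) then 1 else -1

/-- Second sequence. -/
def seqB (i : Fin 69) : ℤ := bif (256171392644615761865 / 2 ^ i.val % 2 == 1) then 1 else -1

lemma seqA_pm (i : Fin 69) : seqA i = 1 ∨ seqA i = -1 := by
  unfold seqA; cases (_ / 2 ^ i.val % 2 == 1) <;> simp

lemma seqB_pm (i : Fin 69) : seqB i = 1 ∨ seqB i = -1 := by
  unfold seqB; cases (_ / 2 ^ i.val % 2 == 1) <;> simp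

/-- The periodic autocorrelation at shift `d`, as a list sum (convenient for evaluation). -/
def pafSum (d : Fin 69) : ℤ :=
  ((List.finRange 69).map (fun j => seqA (d - j) * seqA (-j) + seqB (d - j) * seqB (-j))).sum

lemma pafSum_eq : ∀ d : Fin 69, pafSum d = if d = 0 then 138 else 2 := by
  decide +kernel

/-- The target Gram block `136 I + 2 J`. -/
def gram : Matrix (Fin 69) (Fin 69) ℤ := Matrix.circulant (fun d => if d = 0 then 138 else 2)

lemma gram_eq :
    Matrix.circulant seqA * (Matrix.circulant seqA).transpose
      + Matrix.circulant seqB * (Matrix.circulant seqB).transpose = gram := by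
  rw [Matrix.transpose_circulant, Matrix.transpose_circulant, Matrix.circulant_mul,
    Matrix.circulant_mul, ← Matrix.circulant_add, gram]
  congr 1
  funext d
  rw [← pafSum_eq d, pafSum, ← List.ofFn_eq_map, List.sum_ofFn, Finset.sum_add_distrib]
  rfl

lemma det_gram : gram.det = 136 ^ 68 * 274 := by
  have h : gram.map (Int.castRingHom ℚ) = (136 : ℚ) • (1 +
      Matrix.replicateCol Unit (fun _ : Fin 69 => (1 : ℚ)) *
        Matrix.replicateRow Unit (fun _ : Fin 69 => (1 / 68 : ℚ))) := by
    ext i j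
    simp only [gram, Matrix.map_apply, Matrix.circulant_apply, Matrix.smul_apply,
      Matrix.add_apply, Matrix.mul_apply, Matrix.one_apply, sub_eq_zero]
    split_ifs <;> simp <;> norm_num
  have h2 : ((gram.det : ℤ) : ℚ) = 136 ^ 68 * 274 := by
    have := RingHom.map_det (Int.castRingHom ℚ) gram
    rw [RingHom.mapMatrix_apply, h, Matrix.det_smul,
      Matrix.det_one_add_replicateCol_mul_replicateRow] at this
    simp only [eq_intCast] at this
    rw [this]
    simp [dotProduct]
    norm_num
  exact_mod_cast h2

/-- The two-circulant design. -/
def design : Matrix (Fin 69 ⊕ Fin 69) (Fin 69 ⊕ Fin 69) ℤ :=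
  Matrix.fromBlocks (Matrix.circulant seqA) (Matrix.circulant seqB)
    (-(Matrix.circulant seqB).transpose) (Matrix.circulant seqA).transpose

lemma design_gram : design * design.transpose = Matrix.fromBlocks gram 0 0 gram := by
  have cAB : Matrix.circulant seqA * Matrix.circulant seqB
      = Matrix.circulant seqB * Matrix.circulant seqA := Matrix.circulant_mul_comm _ _
  have cA : (Matrix.circulant seqA).transpose * Matrix.circulant seqA
      = Matrix.circulant seqA * (Matrix.circulant seqA).transpose := by
    rw [Matrix.transpose_circulant]; exact Matrix.circulant_mul_comm _ _
  have cB : (Matrix.circulant seqB).transpose * Matrix.circulant seqB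
      = Matrix.circulant seqB * (Matrix.circulant seqB).transpose := by
    rw [Matrix.transpose_circulant]; exact Matrix.circulant_mul_comm _ _
  rw [design, Matrix.fromBlocks_transpose, Matrix.fromBlocks_multiply]
  simp only [Matrix.transpose_neg, Matrix.transpose_transpose, Matrix.neg_mul, Matrix.mul_neg,
    neg_neg]
  congr 1
  · exact gram_eq
  · rw [cAB]; simp
  · rw [← Matrix.transpose_mul, ← Matrix.transpose_mul, cAB]; simp
  · rw [cA, cB, add_comm]; exact gram_eq

/-- A D-optimal design of order 138 exists: there is a 138×138 matrix with entries
in {+1, −1} whose determinant has absolute value 2^69 · 137 · 68^68,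
the Ehlich–Wojtas bound for order 2v = 138. -/
theorem doptimal_design_order_138 :
    ∃ A : Matrix (Fin 138) (Fin 138) ℤ,
      (∀ i j, A i j = 1 ∨ A i j = -1) ∧
      A.det.natAbs = 2 ^ 69 * 137 * 68 ^ 68 := by
  let e : Fin 69 ⊕ Fin 69 ≃ Fin 138 := finSumFinEquiv
  refine ⟨Matrix.reindex e e design, ?_, ?_⟩
  · intro i j
    rw [Matrix.reindex_apply, Matrix.submatrix_apply]
    generalize e.symm i = x
    generalize e.symm j = y
    rcases x with x | x <;> rcases y with y | y
    · exact seqA_pm _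
    · exact seqB_pm _
    · simp only [design, Matrix.fromBlocks_apply₂₁, Matrix.neg_apply, Matrix.transpose_apply,
        Matrix.circulant_apply]
      rcases seqB_pm (y - x) with h | h <;> simp [h]
    · exact seqA_pm _
  · rw [Matrix.det_reindex_self]
    have h : design.det * design.det = (136 ^ 68 * 274) * (136 ^ 68 * 274) := by
      have h1 := congrArg Matrix.det design_gram
      rwa [Matrix.det_mul, Matrix.det_transpose, Matrix.det_fromBlocks_zero₂₁, det_gram] at h1
    have h3 := Int.natAbs_eq_iff_mul_self_eq.mpr h
    rw [h3]
    norm_num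
end

section
/- There exists a 154 × 154 matrix with all entries in {+1, −1} whose determinant has absolute value 2^77 · 153 · 76^76, i.e., a D-optimal design of order 154 exists. -/
namespace DOpt154

/-- The first base block of a `(77; 34, 31; 27)` supplementary difference set, as a bit mask:
`{1, 2, 3, 4, 8, 11, 12, 15, 16, 17, 18, 20, 23, 24, 26, 30, 32, 35, 37, 40, 42, 43, 44, 45, 48, 55, 58, 59, 69, 70, 71, 72, 75, 76}`. -/
def setA : ℕ := 122192133812899991230750

/-- The second base block, as a bit mask:
`{0, 3, 8, 10, 12, 16, 17, 18, 21, 22, 27, 28, 29, 31, 33, 34, 37, 44, 45, 47, 48, 51, 52, 53, 55, 57, 59, 60, 66, 68, 75}`. -/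
def setB : ℕ := 38149792508427379348745

/-- The `±1` sequence attached to a subset of `ℤ/77`. -/
def seq (m : ℕ) (i : Fin 77) : ℤ := if m.testBit i.val then -1 else 1

lemma seq_pm (m : ℕ) (i : Fin 77) : seq m i = 1 ∨ seq m i = -1 := by
  unfold seq; split_ifs <;> simp

/-- Periodic autocorrelations of the two sequences add up to `2` off the origin. -/
lemma paf : ∀ i : Fin 77,
    ((List.finRange 77).map fun k => seq setA (i - k) * seq setA (-k)
      + seq setB (i - k) * seq setB (-k)).sum = if i = 0 then 154 else 2 := by
  decide +kernel

/-- The target Gram block `152 I + 2 J`. -/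
def gram : Matrix (Fin 77) (Fin 77) ℤ := Matrix.of fun i j => if i = j then 154 else 2

lemma gram_det : gram.det = 2 ^ 77 * 153 * 76 ^ 76 := by
  have h : ((gram.map (Int.castRingHom ℚ)).det) = 2 ^ 77 * 153 * 76 ^ 76 := by
    have e : gram.map (Int.castRingHom ℚ) = (152 : ℚ) • (1 +
        Matrix.replicateCol Unit (fun _ : Fin 77 => (1 / 76 : ℚ)) *
        Matrix.replicateRow Unit (fun _ : Fin 77 => (1 : ℚ))) := by
      ext i j
      by_cases hij : i = j
      · subst hij
        simp [gram, Matrix.mul_apply]; norm_num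
      · simp [gram, Matrix.mul_apply, hij]; norm_num
    rw [e, Matrix.det_smul, Matrix.det_one_add_replicateCol_mul_replicateRow]
    rw [dotProduct, Finset.sum_const, Finset.card_univ, Fintype.card_fin]
    norm_num
  have h2 := RingHom.map_det (Int.castRingHom ℚ) gram
  rw [RingHom.mapMatrix_apply, h] at h2
  have h3 : ((gram.det : ℤ) : ℚ) = ((2 ^ 77 * 153 * 76 ^ 76 : ℤ) : ℚ) := by
    rw [eq_intCast] at h2
    rw [h2]; norm_num
  exact_mod_cast h3

open Matrix

/-- First circulant block. -/
def cA : Matrix (Fin 77) (Fin 77) ℤ := circulant (seq setA)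

/-- Second circulant block. -/
def cB : Matrix (Fin 77) (Fin 77) ℤ := circulant (seq setB)

lemma block_gram : cA * cAᵀ + cB * cBᵀ = gram := by
  unfold cA cB
  rw [Fin.transpose_circulant, Fin.transpose_circulant, Fin.circulant_mul, Fin.circulant_mul,
    ← circulant_add]
  ext i j
  rw [circulant_apply]
  have := paf (i - j)
  rw [← Fin.sum_univ_def, Finset.sum_add_distrib] at this
  simp only [Pi.add_apply, mulVec, dotProduct, circulant_apply, gram, of_apply]
  rw [this]
  simp only [sub_eq_zero]

lemma comm_AB : cA * cB = cB * cA := Fin.circulant_mul_comm _ _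

lemma comm_A : cAᵀ * cA = cA * cAᵀ := by
  unfold cA
  rw [Fin.transpose_circulant, Fin.circulant_mul_comm]

lemma comm_B : cBᵀ * cB = cB * cBᵀ := by
  unfold cB
  rw [Fin.transpose_circulant, Fin.circulant_mul_comm]

/-- The two-circulant matrix. -/
def design : Matrix (Fin 77 ⊕ Fin 77) (Fin 77 ⊕ Fin 77) ℤ := fromBlocks cA cB (-cBᵀ) cAᵀ

lemma design_gram : design * designᵀ = fromBlocks gram 0 0 gram := by
  unfold design
  rw [fromBlocks_transpose, fromBlocks_multiply]
  congr 1
  · exact block_gram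
  · simp [comm_AB]
  · rw [Matrix.neg_mul, ← transpose_mul, ← transpose_mul, comm_AB]; simp
  · simp only [transpose_neg, transpose_transpose, neg_mul_neg]
    rw [comm_A, comm_B, add_comm]; exact block_gram

lemma design_det : design.det.natAbs = 2 ^ 77 * 153 * 76 ^ 76 := by
  have h := congrArg Matrix.det design_gram
  rw [det_mul, det_transpose, det_fromBlocks_zero₂₁, gram_det] at h
  have h2 := Int.natAbs_eq_iff_mul_self_eq.mpr h
  rw [h2]; norm_num

end DOpt154

/-- A D-optimal design of order 154 exists: there is a 154×154 matrix with entries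
in {+1, −1} whose determinant has absolute value 2^77 · 153 · 76^76,
the Ehlich–Wojtas bound for order 2v = 154. -/
theorem doptimal_design_order_154 :
    ∃ A : Matrix (Fin 154) (Fin 154) ℤ,
      (∀ i j, A i j = 1 ∨ A i j = -1) ∧
      A.det.natAbs = 2 ^ 77 * 153 * 76 ^ 76 := by
  let e : Fin 154 ≃ Fin 77 ⊕ Fin 77 := (finSumFinEquiv (m := 77) (n := 77)).symm
  refine ⟨DOpt154.design.submatrix e e, ?_, ?_⟩
  · intro i j
    rw [Matrix.submatrix_apply]
    unfold DOpt154.design DOpt154.cA DOpt154.cB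
    rcases e i with x | x <;> rcases e j with y | y
    · exact DOpt154.seq_pm _ _
    · exact DOpt154.seq_pm _ _
    · have := DOpt154.seq_pm DOpt154.setB (y - x)
      simp only [Matrix.fromBlocks_apply₂₁, Matrix.neg_apply, Matrix.transpose_apply,
        Matrix.circulant_apply]
      omega
    · exact DOpt154.seq_pm _ _
  · rw [Matrix.det_submatrix_equiv_self]
    exact DOpt154.design_det
end

section
/- There exists a 174 × 174 matrix with all entries in {+1, −1} whose determinant has absolute value 2^87 · 173 · 86^86, i.e., a D-optimal design of order 174 exists. -/
open scoped Matrix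

/-- Bit pattern of the first row of the first circulant block. -/
def bitsA : ℕ := 5709330401944675909313203

/-- Bit pattern of the first row of the second circulant block. -/
def bitsB : ℕ := 17159877219031213085388959

/-- The `±1` sequence encoded by a bit pattern. -/
def seqOf (N : ℕ) (i : Fin 87) : ℤ := if N.testBit i.val then 1 else -1

lemma seqOf_pm (N : ℕ) (i : Fin 87) : seqOf N i = 1 ∨ seqOf N i = -1 := by
  unfold seqOf
  split_ifs <;> simp

/-- The periodic autocorrelations of the two sequences sum to `2` at every nonzero shift. -/
lemma paf_sum : ∀ i : Fin 87,
    (∑ j, seqOf bitsA (i - j) * seqOf bitsA (-j)) + (∑ j, seqOf bitsB (i - j) * seqOf bitsB (-j))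
      = if i = 0 then 174 else 2 := by
  decide +kernel

/-- The common value of the diagonal blocks of the Gram matrix. -/
def gramBlock : Matrix (Fin 87) (Fin 87) ℤ := Matrix.of fun i j => if i = j then 174 else 2

lemma gram_eq_s19 :
    Matrix.circulant (seqOf bitsA) * (Matrix.circulant (seqOf bitsA))ᵀ +
      Matrix.circulant (seqOf bitsB) * (Matrix.circulant (seqOf bitsB))ᵀ = gramBlock := by
  rw [Matrix.transpose_circulant, Matrix.transpose_circulant, Matrix.Fin.circulant_mul,
    Matrix.Fin.circulant_mul, ← Matrix.circulant_add]
  ext i j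
  have h := paf_sum (i - j)
  simp only [Matrix.circulant_apply, gramBlock, Matrix.of_apply, Pi.add_apply, Matrix.mulVec,
    dotProduct]
  rw [h]
  simp only [sub_eq_zero]

lemma gram_det : gramBlock.det = 2 ^ 87 * 173 * 86 ^ 86 := by
  have hmap : (gramBlock.map (Int.castRingHom ℚ)) =
      (172 : ℚ) • (1 + Matrix.replicateCol Unit (fun _ : Fin 87 => (1 / 86 : ℚ)) *
        Matrix.replicateRow Unit (fun _ : Fin 87 => (1 : ℚ))) := by
    ext i j
    by_cases h : i = j <;>
      simp [gramBlock, Matrix.mul_apply, h] <;> norm_num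
  have hdet : ((gramBlock.det : ℤ) : ℚ) = 2 ^ 87 * 173 * 86 ^ 86 := by
    have h1 : ((gramBlock.det : ℤ) : ℚ) = (gramBlock.map (Int.castRingHom ℚ)).det :=
      RingHom.map_det (Int.castRingHom ℚ) gramBlock
    rw [h1, hmap, Matrix.det_smul, Matrix.det_one_add_replicateCol_mul_replicateRow]
    simp [dotProduct]
    norm_num
  exact_mod_cast hdet

/-- The two-circulant matrix. -/
def twoCirc : Matrix (Fin 87 ⊕ Fin 87) (Fin 87 ⊕ Fin 87) ℤ :=
  Matrix.fromBlocks (Matrix.circulant (seqOf bitsA)) (Matrix.circulant (seqOf bitsB))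
    (-(Matrix.circulant (seqOf bitsB))ᵀ) (Matrix.circulant (seqOf bitsA))ᵀ

lemma twoCirc_gram : twoCirc * twoCircᵀ = Matrix.fromBlocks gramBlock 0 0 gramBlock := by
  unfold twoCirc
  rw [Matrix.fromBlocks_transpose, Matrix.fromBlocks_multiply]
  have hc : ∀ x y : Fin 87 → ℤ, Matrix.circulant x * Matrix.circulant y =
      Matrix.circulant y * Matrix.circulant x := Matrix.Fin.circulant_mul_comm
  congr 1
  · exact gram_eq_s19
  · simp [hc (seqOf bitsB) (seqOf bitsA)]
  · simp only [Matrix.transpose_circulant, Matrix.transpose_neg, Matrix.neg_mul,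
      Matrix.transpose_transpose]
    rw [hc, neg_add_cancel]
  · rw [← gram_eq_s19]
    simp only [Matrix.transpose_circulant, Matrix.transpose_neg, Matrix.neg_mul,
      Matrix.mul_neg, neg_neg, Matrix.transpose_transpose]
    rw [hc _ (seqOf bitsA), hc _ (seqOf bitsB), add_comm]

lemma twoCirc_det : twoCirc.det.natAbs = 2 ^ 87 * 173 * 86 ^ 86 := by
  have h : twoCirc.det ^ 2 = gramBlock.det ^ 2 := by
    have h2 := congrArg Matrix.det twoCirc_gram
    rw [Matrix.det_mul, Matrix.det_transpose, Matrix.det_fromBlocks_zero₂₁] at h2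
    rw [sq, sq, h2]
  rw [Int.natAbs_eq_iff_sq_eq.mpr h, gram_det]
  norm_num

lemma twoCirc_pm (i j) : twoCirc i j = 1 ∨ twoCirc i j = -1 := by
  rcases i with i | i <;> rcases j with j | j
  · exact seqOf_pm _ _
  · exact seqOf_pm _ _
  · have := seqOf_pm bitsB (j - i)
    simp only [twoCirc, Matrix.fromBlocks_apply₂₁, Matrix.neg_apply, Matrix.transpose_apply,
      Matrix.circulant_apply]
    omega
  · exact seqOf_pm _ _

/-- A D-optimal design of order 174 exists: there is a 174×174 matrix with entries
in {+1, −1} whose determinant has absolute value 2^87 · 173 · 86^86,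
the Ehlich–Wojtas bound for order 2v = 174. -/
theorem doptimal_design_order_174 :
    ∃ A : Matrix (Fin 174) (Fin 174) ℤ,
      (∀ i j, A i j = 1 ∨ A i j = -1) ∧
      A.det.natAbs = 2 ^ 87 * 173 * 86 ^ 86 := by
  let e : Fin 87 ⊕ Fin 87 ≃ Fin 174 := finSumFinEquiv
  refine ⟨Matrix.reindex e e twoCirc, fun i j => twoCirc_pm _ _, ?_⟩
  rw [Matrix.det_reindex_self]
  exact twoCirc_det
end
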